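/- Inflated correlation factorization along chordless and unique paths. Let K = Σ⁻¹ be adapted to G = (V,E) and let π be a path between x and y in G with P = V(π). If π is chordless, then ω(π, Φ^P_{PP·P̄}) = ϱ^P_{xy·P̄}, so that ω(π, Φ^V) = ϱ^P_{xy·P̄} × IF_P. If moreover π is the unique path between x and y in G, then ω(π, Φ^V) = ϱ^V_xy, so that ϱ^V_xy = ϱ^P_{xy·P̄} × IF_P. -/

import Mathlib

open Matrix BigOperators Finset

variable {V : Type*} [Fintype V] [DecidableEq V]

/-- Submatrix of `M` with rows indexed by `A` and columns indexed by `B`. -/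
noncomputable def subm (M : Matrix V V ℝ) (A B : Finset V) : Matrix ↥A ↥B ℝ :=
  Matrix.of fun i j => M i.1 j.1

/-- Partial covariance matrix `Σ_{AA·B}` of `A` given a disjoint set `B`. -/
noncomputable def pcovOn (M : Matrix V V ℝ) (A B : Finset V) : Matrix ↥A ↥A ℝ :=
  subm M A A - subm M A B * (subm M B B)⁻¹ * subm M B A

/-- Partial covariance matrix `Σ_{AA·Ā}` given the complement of `A`. -/
noncomputable def pcov (M : Matrix V V ℝ) (A : Finset V) : Matrix ↥A ↥A ℝ :=
  pcovOn M A Aᶜ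

/-- Inflation factor of `A` on `B`. -/
noncomputable def inflF (M : Matrix V V ℝ) (A B : Finset V) : ℝ :=
  ((subm M A A).det * (subm M B B).det) / (subm M (A ∪ B) (A ∪ B)).det

/-- The path weight `ω(π, Γ)` of a walk `p`, computed from `Θ = Γ⁻¹`. -/
noncomputable def pathWeight (Γ : Matrix V V ℝ) {G : SimpleGraph V} {x y : V}
    (p : G.Walk x y) : ℝ :=
  (-1 : ℝ) ^ (p.support.toFinset.card + 1) *
    ((subm Γ⁻¹ p.support.toFinsetᶜ p.support.toFinsetᶜ).det / Γ⁻¹.det) *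
    (p.darts.map fun d => Γ⁻¹ d.toProd.1 d.toProd.2).prod

/-- The partial covariance weight `ω(π, Σ_{AA·Ā})` of a walk `p` with vertices in `A`,
expressed via `K = Σ⁻¹`: `(−1)^{|P|+1} (det K_{A∖P,A∖P}/det K_AA) ∏ κ_uv`. -/
noncomputable def partialPathWeight (S : Matrix V V ℝ) (A : Finset V) {G : SimpleGraph V}
    {x y : V} (p : G.Walk x y) : ℝ :=
  (-1 : ℝ) ^ (p.support.toFinset.card + 1) *
    ((subm S⁻¹ (A \ p.support.toFinset) (A \ p.support.toFinset)).det /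
      (subm S⁻¹ A A).det) *
    (p.darts.map fun d => S⁻¹ d.toProd.1 d.toProd.2).prod

/-- `K` is adapted to `G` when nonzero off-diagonal entries correspond to edges. -/
def Adapted (K : Matrix V V ℝ) (G : SimpleGraph V) : Prop :=
  ∀ u v : V, u ≠ v → K u v ≠ 0 → G.Adj u v

/-- Correlation-type scaling of a positive definite matrix. -/
noncomputable def corrScale {ι : Type*} (M : Matrix ι ι ℝ) : Matrix ι ι ℝ :=
  Matrix.of fun i j => M i j / (Real.sqrt (M i i) * Real.sqrt (M j j))

/-- The inflated correlation matrix `Φ^V = diag(K)^{1/2} Σ diag(K)^{1/2}`. -/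
noncomputable def inflCorr (S : Matrix V V ℝ) : Matrix V V ℝ :=
  Matrix.of fun u v => Real.sqrt (S⁻¹ u u) * S u v * Real.sqrt (S⁻¹ v v)

/-- The weight `ω(π, M)` of a walk `p` whose vertices lie in `P`, computed in the
induced subgraph from a matrix `M` indexed by `P`; here `V(π) = P`, so the determinant
factor (over the empty set) is `1`. -/
noncomputable def subPathWeight {P : Finset V} (M : Matrix ↥P ↥P ℝ) {G : SimpleGraph V}
    {x y : V} (p : G.Walk x y) (hp : ∀ v ∈ p.support, v ∈ P) : ℝ :=
  (-1 : ℝ) ^ (p.support.toFinset.card + 1) * (1 / M⁻¹.det) *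
    (p.darts.attach.map fun d =>
      M⁻¹ ⟨d.1.toProd.1, hp _ (SimpleGraph.Walk.dart_fst_mem_support_of_mem_darts p d.2)⟩
          ⟨d.1.toProd.2, hp _ (SimpleGraph.Walk.dart_snd_mem_support_of_mem_darts p d.2)⟩).prod

/-- Product of partial correlations `ρ_{uv·V∖{u,v}} = −κ_uv/(√κ_uu √κ_vv)`
over the edges of a walk. -/
noncomputable def prodPartialCorr (S : Matrix V V ℝ) {G : SimpleGraph V} {x y : V}
    (p : G.Walk x y) : ℝ :=
  (p.darts.map fun d => -(corrScale S⁻¹ d.toProd.1 d.toProd.2)).prod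

/-- A walk is chordless if every edge of `G` joining two of its vertices is an edge of
the walk. -/
def Chordless {G : SimpleGraph V} {x y : V} (p : G.Walk x y) : Prop :=
  ∀ u v : V, u ∈ p.support → v ∈ p.support → G.Adj u v → s(u, v) ∈ p.edges

/-- The quantity `φ(π, R) = det((I−R)_{P̄P̄}) ∏ ρ_{uv·V∖{u,v}}`. -/
noncomputable def phiWeight (S : Matrix V V ℝ) {G : SimpleGraph V} {x y : V}
    (p : G.Walk x y) : ℝ :=
  (subm (corrScale S⁻¹) p.support.toFinsetᶜ p.support.toFinsetᶜ).det * prodPartialCorr S p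

/-- Jacobi's identity for complementary principal minors of a matrix and its inverse. -/
theorem det_mul_det_toSquareBlockProp {n : Type*} [Fintype n] [DecidableEq n]
    {A B : Matrix n n ℝ} (h : A * B = 1) (q : n → Prop) [DecidablePred q] :
    A.det * (toSquareBlockProp B q).det = (toSquareBlockProp A fun i => ¬q i).det := by
  set L : Matrix n n ℝ := Matrix.of fun i j => if q j then B i j else (1 : Matrix n n ℝ) i j
    with hL
  have hAL : ∀ i j, (A * L) i j = if q j then (1 : Matrix n n ℝ) i j else A i j := by
    intro i j
    split_ifs with hj
    · rw [← h]
      simp [hL, mul_apply, hj]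
    · conv_rhs => rw [← mul_one A]
      simp only [hL, mul_apply, of_apply, hj, if_false]
  have h₁ : L.det = (toSquareBlockProp B q).det := by
    rw [twoBlockTriangular_det' L q]
    · have e₁ : toSquareBlockProp L q = toSquareBlockProp B q := by
        ext i j
        simp [toSquareBlockProp, hL, j.2]
      have e₂ : (toSquareBlockProp L fun i => ¬q i) = 1 := by
        ext i j
        simp [toSquareBlockProp, hL, j.2, one_apply, Subtype.ext_iff]
      rw [e₁, e₂, det_one, mul_one]
    · intro i hi j hj
      have : i ≠ j := by rintro rfl; exact hj hi
      simp [hL, hj, this]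
  rw [← h₁, ← det_mul, twoBlockTriangular_det _ q]
  · have e₁ : toSquareBlockProp (A * L) q = 1 := by
      ext i j
      simp [toSquareBlockProp, hAL, j.2, one_apply, Subtype.ext_iff]
    have e₂ : (toSquareBlockProp (A * L) fun i => ¬q i) = toSquareBlockProp A fun i => ¬q i := by
      ext i j
      simp [toSquareBlockProp, hAL, j.2]
    rw [e₁, e₂, det_one, one_mul]
  · intro i hi j hj
    have : i ≠ j := by rintro rfl; exact hi hj
    simp [hAL, hj, this]

theorem subm_posDef {V : Type*} {M : Matrix V V ℝ} (hM : M.PosDef) (A : Finset V) :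
    (subm M A A).PosDef :=
  hM.submatrix Subtype.val_injective

theorem det_mul_det_subm {A B : Matrix V V ℝ} (h : A * B = 1) (P : Finset V) :
    A.det * (subm B P P).det = (subm A Pᶜ Pᶜ).det := by
  have := det_mul_det_toSquareBlockProp h (· ∈ P)
  have e : (subm A Pᶜ Pᶜ).det = (toSquareBlockProp A fun i => i ∉ P).det := by
    rw [← det_submatrix_equiv_self (Equiv.subtypeEquivRight fun i => (mem_compl (s := P)).symm)]
    rfl
  rw [e, ← this]
  congr!

theorem subm_mul_add (A B : Matrix V V ℝ) (P Q R : Finset V) :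
    subm A P R * subm B R Q + subm A P Rᶜ * subm B Rᶜ Q = subm (A * B) P Q := by
  ext i j
  simp only [Matrix.add_apply, mul_apply, subm, of_apply]
  rw [← Finset.sum_add_sum_compl R, ← Finset.sum_coe_sort R, ← Finset.sum_coe_sort Rᶜ]

/-- The partial covariance matrix is the inverse of the corresponding block of the
precision matrix. -/
theorem pcov_eq_inv {M : Matrix V V ℝ} (hM : M.PosDef) (P : Finset V) :
    pcov M P = (subm M⁻¹ P P)⁻¹ := by
  have h : M * M⁻¹ = 1 := mul_nonsing_inv _ hM.det_pos.ne'.isUnit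
  have h₁ := subm_mul_add M M⁻¹ P P P
  have h₂ := subm_mul_add M M⁻¹ Pᶜ P P
  have e₁ : subm (1 : Matrix V V ℝ) P P = 1 := by
    ext i j
    simp only [subm, of_apply, one_apply, Subtype.ext_iff]
  have e₂ : subm (1 : Matrix V V ℝ) Pᶜ P = 0 := by
    ext i j
    exact one_apply_ne fun hij : i.1 = j.1 => mem_compl.1 i.2 (hij ▸ j.2)
  rw [h, e₁] at h₁
  rw [h, e₂] at h₂
  symm
  apply inv_eq_left_inv
  have hu := (subm_posDef hM Pᶜ).det_pos.ne'.isUnit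
  have h₃ : subm M⁻¹ Pᶜ P = -((subm M Pᶜ Pᶜ)⁻¹ * (subm M Pᶜ P * subm M⁻¹ P P)) := by
    rw [eq_neg_of_add_eq_zero_left h₂, Matrix.mul_neg, neg_neg,
      nonsing_inv_mul_cancel_left _ _ hu]
  rw [← h₁, h₃, pcov, pcovOn]
  rw [Matrix.sub_mul, Matrix.mul_neg, ← sub_eq_add_neg]
  simp only [Matrix.mul_assoc]

theorem inv_subm_diag {V : Type*} [DecidableEq V] {K : Matrix V V ℝ}
    (hK : K.PosDef) (A : Finset V) (x : ↥A) :
    (subm K A A)⁻¹ x x = (subm K (A.erase x) (A.erase x)).det / (subm K A A).det := by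
  have hA := subm_posDef hK A
  have h := det_mul_det_toSquareBlockProp (mul_nonsing_inv _ hA.det_pos.ne'.isUnit) (· = x)
  have e₁ : (toSquareBlockProp (subm K A A)⁻¹ (· = x)).det = (subm K A A)⁻¹ x x := by
    rw [det_unique]
    rfl
  have e₂ : (subm K (A.erase x) (A.erase x)).det
      = (toSquareBlockProp (subm K A A) fun i => ¬i = x).det := by
    let e : {i : ↥A // ¬i = x} ≃ ↥(A.erase x) :=
      { toFun := fun i => ⟨i.1.1, mem_erase.2 ⟨fun h => i.2 (Subtype.ext h), i.1.2⟩⟩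
        invFun := fun i => ⟨⟨i.1, mem_of_mem_erase i.2⟩,
          fun h => ne_of_mem_erase i.2 (congrArg Subtype.val h)⟩
        left_inv := fun _ => rfl
        right_inv := fun _ => rfl }
    rw [← det_submatrix_equiv_self e]
    rfl
  rw [e₂, ← h, eq_div_iff hA.det_pos.ne', mul_comm, ← e₁]
  congr!

/-- Expansion of an off-diagonal entry of the inverse by removing the row index. -/
theorem inv_subm_off_diag {V : Type*} [DecidableEq V] {K : Matrix V V ℝ}
    (hK : K.PosDef) (A : Finset V) (x : ↥A)
    (y : ↥(A.erase x)) :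
    (subm K A A)⁻¹ x ⟨y, mem_of_mem_erase y.2⟩ =
      -((subm K (A.erase x) (A.erase x)).det / (subm K A A).det) *
        ∑ u : ↥(A.erase x), K x u * (subm K (A.erase x) (A.erase x))⁻¹ u y := by
  have hA := subm_posDef hK A
  have hB := (subm_posDef hK (A.erase x)).det_pos.ne'.isUnit
  set N := (subm K A A)⁻¹ with hN
  let n : ↥(A.erase x) → ℝ := fun u => N x ⟨u, mem_of_mem_erase u.2⟩
  have h₀ : N * subm K A A = 1 := nonsing_inv_mul _ hA.det_pos.ne'.isUnit
  have h₁ : n ᵥ* subm K (A.erase x) (A.erase x)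
      = (-N x x) • fun u : ↥(A.erase x) => K x u := by
    ext u
    have hu : x ≠ ⟨u, mem_of_mem_erase u.2⟩ :=
      fun h => ne_of_mem_erase u.2 (congrArg Subtype.val h).symm
    have h := congrFun (congrFun h₀ x) ⟨u, mem_of_mem_erase u.2⟩
    rw [one_apply_ne hu, mul_apply] at h
    let f : V → ℝ := fun w => if hw : w ∈ A then N x ⟨w, hw⟩ * K w u else 0
    have hf : ∑ w : ↥A, N x w * subm K A A w ⟨u, mem_of_mem_erase u.2⟩ = ∑ w ∈ A, f w := by
      rw [← Finset.sum_coe_sort A]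
      refine Finset.sum_congr rfl fun w _ => ?_
      simp [f, subm]
    have hf' : (n ᵥ* subm K (A.erase x) (A.erase x)) u = ∑ w ∈ A.erase x, f w := by
      rw [← Finset.sum_coe_sort (A.erase x)]
      refine Finset.sum_congr rfl fun w _ => ?_
      simp [f, subm, n, mem_of_mem_erase w.2]
    rw [hf, ← Finset.add_sum_erase A f x.2, ← hf'] at h
    have hfx : f x = N x x * K x u := by simp [f]
    simp only [Pi.smul_apply, smul_eq_mul]
    linarith
  have h₂ : n = ((-N x x) • fun u : ↥(A.erase x) => K x u) ᵥ*
      (subm K (A.erase x) (A.erase x))⁻¹ := by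
    rw [← h₁, vecMul_vecMul, mul_nonsing_inv _ hB, vecMul_one]
  rw [← inv_subm_diag hK A x, ← hN]
  have := congrFun h₂ y
  rw [smul_vecMul] at this
  exact this

theorem inv_subm_eq_zero {V : Type*} [DecidableEq V] {K : Matrix V V ℝ}
    (hK : K.PosDef) {G : SimpleGraph V}
    (hadapt : Adapted K G) (k : ℕ) (A : Finset V) (hk : A.card = k) (x y : ↥A)
    (h : ∀ q : G.Walk x.1 y.1, q.IsPath → ¬∀ v ∈ q.support, v ∈ A) :
    (subm K A A)⁻¹ x y = 0 := by
  induction k generalizing A with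
  | zero => exact absurd x.2 (by simp [Finset.card_eq_zero.1 hk])
  | succ k ih =>
    have hyx : y.1 ≠ x.1 := by
      rintro hyx
      obtain ⟨x, hx⟩ := x
      obtain ⟨y, hy⟩ := y
      subst hyx
      exact h SimpleGraph.Walk.nil SimpleGraph.Walk.IsPath.nil (by simpa using hx)
    have := inv_subm_off_diag hK A x ⟨y, mem_erase.2 ⟨hyx, y.2⟩⟩
    rw [Subtype.coe_eta] at this
    rw [this, Finset.sum_eq_zero, mul_zero]
    intro u _
    by_cases hu : K x u = 0
    · rw [hu, zero_mul]
    · have hadj := hadapt _ _ (ne_of_mem_erase u.2).symm hu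
      rw [ih _ (by rw [card_erase_of_mem x.2, hk]; rfl), mul_zero]
      intro q hq hqA
      refine h (.cons hadj q) (hq.cons fun hx => ?_) ?_
      · exact ne_of_mem_erase (hqA _ hx) rfl
      · simpa using fun v hv => mem_of_mem_erase (hqA v hv)

/-- If `p` is the only path inside `A` between its endpoints, then the corresponding entry of
the inverse of the block `K_AA` is the weight of `p`. -/
theorem inv_subm_eq_of_unique_path {V : Type*} [DecidableEq V] {K : Matrix V V ℝ}
    (hK : K.PosDef) {G : SimpleGraph V}
    (hadapt : Adapted K G) {x y : V} (p : G.Walk x y) (hp : p.IsPath) (A : Finset V)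
    (hpA : ∀ v ∈ p.support, v ∈ A)
    (huniq : ∀ q : G.Walk x y, q.IsPath → (∀ v ∈ q.support, v ∈ A) → q = p) :
    (subm K A A)⁻¹ ⟨x, hpA _ p.start_mem_support⟩ ⟨y, hpA _ p.end_mem_support⟩ =
      (-1 : ℝ) ^ (p.support.toFinset.card + 1) *
        ((subm K (A \ p.support.toFinset) (A \ p.support.toFinset)).det / (subm K A A).det) *
        (p.darts.map fun d => K d.toProd.1 d.toProd.2).prod := by
  induction p generalizing A with
  | nil =>
    rename_i u
    have hset : A \ (SimpleGraph.Walk.nil : G.Walk u u).support.toFinset = A.erase u := by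
      ext w
      simp [and_comm]
    rw [inv_subm_diag hK A, hset]
    simp
  | @cons x v y hadj p ih =>
    obtain ⟨hp', hx⟩ := (SimpleGraph.Walk.cons_isPath_iff _ _).1 hp
    have hxA : x ∈ A := hpA _ (by simp)
    have hpB : ∀ w ∈ p.support, w ∈ A.erase x := fun w hw =>
      mem_erase.2 ⟨fun h => hx (h ▸ hw), hpA w (by simp [hw])⟩
    have key : ∀ (u : V) (hadj' : G.Adj x u) (q : G.Walk u y), q.IsPath →
        (∀ w ∈ q.support, w ∈ A.erase x) →
        SimpleGraph.Walk.cons hadj' q = SimpleGraph.Walk.cons hadj p := by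
      intro u hadj' q hq hqA
      refine huniq _ (hq.cons fun hx => ne_of_mem_erase (hqA _ hx) rfl) ?_
      simpa [hxA] using fun v hv => mem_of_mem_erase (hqA v hv)
    have ih' := ih hp' (A.erase x) hpB (fun q hq hqA => by simpa using key v hadj q hq hqA)
    have hexp := inv_subm_off_diag hK A ⟨x, hxA⟩ ⟨y, hpB _ p.end_mem_support⟩
    have hsum : ∑ u : ↥(A.erase x),
        K x u * (subm K (A.erase x) (A.erase x))⁻¹ u ⟨y, hpB _ p.end_mem_support⟩ =
        K x v * (subm K (A.erase x) (A.erase x))⁻¹ ⟨v, hpB _ p.start_mem_support⟩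
          ⟨y, hpB _ p.end_mem_support⟩ := by
      refine Fintype.sum_eq_single (⟨v, hpB _ p.start_mem_support⟩ : ↥(A.erase x)) ?_
      intro u huv
      by_cases hu : K x u = 0
      · rw [hu, zero_mul]
      · have hadj' := hadapt _ _ (ne_of_mem_erase u.2).symm hu
        rw [inv_subm_eq_zero hK hadapt _ _ rfl, mul_zero]
        intro q hq hqA
        have := key u hadj' q hq hqA
        exact huv (Subtype.ext (by simpa using congrArg SimpleGraph.Walk.snd this))
    have hset : A \ (SimpleGraph.Walk.cons hadj p).support.toFinset
        = A.erase x \ p.support.toFinset := by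
      ext w
      simp only [SimpleGraph.Walk.support_cons, List.toFinset_cons, mem_sdiff, mem_insert,
        mem_erase]
      tauto
    have hcard : (SimpleGraph.Walk.cons hadj p).support.toFinset.card
        = p.support.toFinset.card + 1 := by
      rw [SimpleGraph.Walk.support_cons, List.toFinset_cons, card_insert_of_notMem (by simpa)]
    refine hexp.trans ?_
    rw [hsum, ih', hset, hcard, SimpleGraph.Walk.darts_cons, List.map_cons, List.prod_cons]
    have h₁ := (subm_posDef hK (A.erase x)).det_pos.ne'
    have h₂ := (subm_posDef hK A).det_pos.ne'
    field_simp
    ring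

/-- A chordless path is the only path between its endpoints among its own vertices. -/
theorem eq_of_chordless {V : Type*} {G : SimpleGraph V} {x y : V} (p : G.Walk x y) (hp : p.IsPath)
    (hc : Chordless p) (q : G.Walk x y) (hq : q.IsPath) (hqp : ∀ v ∈ q.support, v ∈ p.support) :
    q = p := by
  induction p with
  | nil => exact SimpleGraph.Walk.eq_nil_iff_nil.2 (SimpleGraph.Walk.isPath_iff_nil.1 hq)
  | @cons x v y hadj p ih =>
    obtain ⟨hp', hx⟩ := (SimpleGraph.Walk.cons_isPath_iff _ _).1 hp
    cases q with
    | nil => exact absurd p.end_mem_support hx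
    | @cons _ u _ hadj' q =>
      obtain ⟨hq', hxq⟩ := (SimpleGraph.Walk.cons_isPath_iff _ _).1 hq
      have hu := hc x u (by simp) (hqp u (by simp)) hadj'
      have huv : u = v := by
        rw [SimpleGraph.Walk.edges_cons, List.mem_cons] at hu
        rcases hu with hu | hu
        · exact Sym2.congr_right.1 hu
        · exact absurd (p.fst_mem_support_of_mem_edges hu) hx
      subst huv
      congr 1
      refine ih hp' ?_ q hq' ?_
      · intro a b ha hb hab
        have := hc a b (by simp [ha]) (by simp [hb]) hab
        rw [SimpleGraph.Walk.edges_cons, List.mem_cons] at this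
        rcases this with h | h
        · rcases Sym2.eq_iff.1 h with ⟨rfl, -⟩ | ⟨-, rfl⟩
          · exact absurd ha hx
          · exact absurd hb hx
        · exact h
      · intro w hw
        have := hqp w (by simp [hw])
        rw [SimpleGraph.Walk.support_cons, List.mem_cons] at this
        rcases this with rfl | h
        · exact absurd hw hxq
        · exact h

theorem inflCorr_eq (S : Matrix V V ℝ) :
    inflCorr S = diagonal (fun u => √(S⁻¹ u u)) * S * diagonal fun u => √(S⁻¹ u u) := by
  ext u v
  simp [inflCorr]

theorem sqrt_inv_diag_pos {S : Matrix V V ℝ} (hS : S.PosDef) (u : V) : 0 < √(S⁻¹ u u) :=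
  Real.sqrt_pos.2 hS.inv.diag_pos

theorem inflCorr_posDef {S : Matrix V V ℝ} (hS : S.PosDef) : (inflCorr S).PosDef := by
  have hD : IsUnit (diagonal fun u => √(S⁻¹ u u)) :=
    (PosDef.diagonal fun u => sqrt_inv_diag_pos hS u).isUnit
  have := hS.conjTranspose_mul_mul_same (mulVec_injective_of_isUnit hD)
  rw [inflCorr_eq]
  simpa [diagonal_conjTranspose] using this

theorem inflCorr_inv_apply {S : Matrix V V ℝ} (hS : S.PosDef) (u v : V) :
    (inflCorr S)⁻¹ u v = (√(S⁻¹ u u))⁻¹ * S⁻¹ u v * (√(S⁻¹ v v))⁻¹ := by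
  have h : (diagonal fun u => √(S⁻¹ u u))⁻¹ = diagonal fun u => (√(S⁻¹ u u))⁻¹ := by
    refine inv_eq_left_inv ?_
    rw [diagonal_mul_diagonal, ← diagonal_one]
    congr 1
    ext u
    exact inv_mul_cancel₀ (sqrt_inv_diag_pos hS u).ne'
  rw [inflCorr_eq, Matrix.mul_inv_rev, Matrix.mul_inv_rev, h, ← Matrix.mul_assoc]
  simp

theorem inflCorr_adapted {S : Matrix V V ℝ} (hS : S.PosDef) {G : SimpleGraph V}
    (hadapt : Adapted S⁻¹ G) : Adapted (inflCorr S)⁻¹ G := by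
  intro u v huv h
  refine hadapt u v huv fun h₀ => h ?_
  rw [inflCorr_inv_apply hS, h₀, mul_zero, zero_mul]

theorem det_subm_univ (M : Matrix V V ℝ) : (subm M univ univ).det = M.det := by
  rw [← det_submatrix_equiv_self (Equiv.subtypeUnivEquiv mem_univ).symm]
  rfl

theorem inv_subm_univ (M : Matrix V V ℝ) (x y : V) :
    (subm M univ univ)⁻¹ ⟨x, mem_univ x⟩ ⟨y, mem_univ y⟩ = M⁻¹ x y := by
  have h : subm M univ univ = M.submatrix (Equiv.subtypeUnivEquiv mem_univ)
      (Equiv.subtypeUnivEquiv mem_univ) := rfl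
  rw [h, inv_submatrix_equiv]
  rfl

theorem inflF_compl (M : Matrix V V ℝ) (P : Finset V) :
    inflF M P Pᶜ = (subm M P P).det * (subm M Pᶜ Pᶜ).det / M.det := by
  rw [inflF, union_compl, det_subm_univ]

theorem det_subm_inflCorr (S : Matrix V V ℝ) (A : Finset V) :
    (subm (inflCorr S) A A).det = (∏ u ∈ A, √(S⁻¹ u u)) ^ 2 * (subm S A A).det := by
  have h : subm (inflCorr S) A A = diagonal (fun u : ↥A => √(S⁻¹ u u)) * subm S A A *
      diagonal fun u : ↥A => √(S⁻¹ u u) := by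
    ext u v
    simp [inflCorr, subm]
  rw [h, det_mul, det_mul, det_diagonal, Finset.prod_coe_sort A fun u => √(S⁻¹ u u)]
  ring

theorem inflF_inflCorr {S : Matrix V V ℝ} (hS : S.PosDef) (P : Finset V) :
    inflF (inflCorr S) P Pᶜ = inflF S P Pᶜ := by
  rw [inflF, inflF, det_subm_inflCorr, det_subm_inflCorr, det_subm_inflCorr, union_compl,
    ← Finset.prod_mul_prod_compl P]
  have h : ∀ A : Finset V, ∏ u ∈ A, √(S⁻¹ u u) ≠ 0 := fun A =>
    (Finset.prod_pos fun u _ => sqrt_inv_diag_pos hS u).ne'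
  have h₁ := h P
  have h₂ := h Pᶜ
  have h₃ := (subm_posDef hS univ).det_pos.ne'
  field_simp

theorem inflF_eq_inv {M : Matrix V V ℝ} (hM : M.PosDef) (P : Finset V) :
    inflF M P Pᶜ = (subm M⁻¹ P P).det * (subm M⁻¹ Pᶜ Pᶜ).det / M⁻¹.det := by
  have hu := hM.det_pos.ne'.isUnit
  have h₁ := det_mul_det_subm (nonsing_inv_mul _ hu) P
  have h₂ := det_mul_det_subm (nonsing_inv_mul _ hu) Pᶜ
  have h₃ : M⁻¹.det * M.det = 1 := by rw [← det_mul, nonsing_inv_mul _ hu, det_one]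
  rw [compl_compl] at h₂
  have h₄ := hM.det_pos.ne'
  have h₅ := hM.inv.det_pos.ne'
  rw [inflF_compl, ← h₁, ← h₂, div_eq_div_iff h₄ h₅]
  linear_combination (-(subm M P P).det * (subm M Pᶜ Pᶜ).det * M⁻¹.det) * h₃

/-- inflated correlation factorization along chordless and unique paths:
if `π` is chordless then `ω(π, Φ^P_{PP·P̄}) = ϱ^P_{xy·P̄}` and
`ω(π, Φ^V) = ϱ^P_{xy·P̄} × IF_P`; if moreover `π` is the unique path between `x` and `y`
then `ω(π, Φ^V) = ϱ^V_xy`, so that `ϱ^V_xy = ϱ^P_{xy·P̄} × IF_P`. -/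
theorem inflated_correlation_chordless_unique_path {V : Type*} [Fintype V] [DecidableEq V]
    (S : Matrix V V ℝ) (hS : S.PosDef) (G : SimpleGraph V) [DecidableRel G.Adj]
    (hadapt : Adapted S⁻¹ G) {x y : V} (hxy : x ≠ y) (p : G.Walk x y) (hp : p.IsPath)
    (hchordless : Chordless p) :
    subPathWeight (pcov (inflCorr S) p.support.toFinset) p
        (fun v hv => List.mem_toFinset.mpr hv) =
      pcov (inflCorr S) p.support.toFinset
        ⟨x, List.mem_toFinset.mpr p.start_mem_support⟩
        ⟨y, List.mem_toFinset.mpr p.end_mem_support⟩ ∧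
    pathWeight (inflCorr S) p =
      pcov (inflCorr S) p.support.toFinset
          ⟨x, List.mem_toFinset.mpr p.start_mem_support⟩
          ⟨y, List.mem_toFinset.mpr p.end_mem_support⟩ *
        inflF S p.support.toFinset p.support.toFinsetᶜ ∧
    ((∀ q : G.Walk x y, q.IsPath → q = p) →
      pathWeight (inflCorr S) p = inflCorr S x y ∧
      inflCorr S x y =
        pcov (inflCorr S) p.support.toFinset
            ⟨x, List.mem_toFinset.mpr p.start_mem_support⟩
            ⟨y, List.mem_toFinset.mpr p.end_mem_support⟩ *
          inflF S p.support.toFinset p.support.toFinsetᶜ) := by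
  have hΓ := inflCorr_posDef hS
  have hΘ := hΓ.inv
  have had := inflCorr_adapted hS hadapt
  set Γ := inflCorr S
  set P := p.support.toFinset with hP
  have hPp : ∀ v ∈ p.support, v ∈ P := fun v hv => List.mem_toFinset.mpr hv
  have hdet := (subm_posDef hΘ P).det_pos.ne'
  have hentry : pcov Γ P ⟨x, hPp _ p.start_mem_support⟩ ⟨y, hPp _ p.end_mem_support⟩ =
      (-1 : ℝ) ^ (P.card + 1) * (1 / (subm Γ⁻¹ P P).det) *
        (p.darts.map fun d => Γ⁻¹ d.toProd.1 d.toProd.2).prod := by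
    rw [pcov_eq_inv hΓ, inv_subm_eq_of_unique_path hΘ had p hp P hPp fun q hq hqP =>
      eq_of_chordless p hp hchordless q hq fun v hv => List.mem_toFinset.1 (hqP v hv)]
    have h₁ : (subm Γ⁻¹ (P \ P) (P \ P)).det = 1 := by
      rw [Finset.sdiff_self]
      exact det_isEmpty
    rw [← hP, h₁]
  have hfac : pathWeight Γ p = pcov Γ P ⟨x, hPp _ p.start_mem_support⟩
      ⟨y, hPp _ p.end_mem_support⟩ * inflF S P Pᶜ := by
    rw [hentry, ← inflF_inflCorr hS, inflF_eq_inv hΓ, pathWeight, ← hP]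
    field_simp
  refine ⟨?_, hfac, fun huniq => ?_⟩
  · have hinv : (pcov Γ P)⁻¹ = subm Γ⁻¹ P P := by
      rw [pcov_eq_inv hΓ, nonsing_inv_nonsing_inv _ (subm_posDef hΘ P).det_pos.ne'.isUnit]
    rw [hentry, subPathWeight, hinv]
    congr 2
    exact List.attach_map_val (l := p.darts) (f := fun d => Γ⁻¹ d.toProd.1 d.toProd.2)
  · have hω : pathWeight Γ p = Γ x y := by
      have h := inv_subm_eq_of_unique_path hΘ had p hp univ (fun v _ => mem_univ v)
        fun q hq _ => huniq q hq
      rw [inv_subm_univ, nonsing_inv_nonsing_inv _ hΓ.det_pos.ne'.isUnit, det_subm_univ,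
        ← compl_eq_univ_sdiff] at h
      exact h.symm
    exact ⟨hω, hω ▸ hfac⟩
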